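/- arXiv:1901.08218 — 2 statements merged into one kernel-verified Lean document; each statement's English description precedes it below -/
import Mathlib

section
/- Let Ū : (−1,1) → ℝ be continuous with constants u₋ < 2, u₊ > −2, α ∈ (0,1], C₀ > 0 such that |Ū(x) − u₋| ≤ C₀(1+x)^α on (−1,0] and |Ū(x) − u₊| ≤ C₀(1−x)^α on [0,1). Let ε ∈ (0,1/2) satisfy 4ε > max{u₋, −u₊, 0}, and let ξ : (−1,1) → ℝ be continuous with |ξ(x)| ≤ N(1−x²)^{1−2ε} for all x. Then W(x) := e^{−a(x)} ∫₀ˣ e^{a(s)} ξ(s)/(1−s²) ds is well-defined and C¹ on (−1,1), satisfies the equation (1−x²)W'(x) + (2x + Ū(x))W(x) = ξ(x), and there exists C > 0 depending only on ε, u₋, u₊, α, C₀ such that |W(x)| ≤ C·N·(1−x²)^{1−2ε} and |(1−x²)^{2ε}W'(x)| ≤ C·N for all x ∈ (−1,1); in particular W(x) → 0 as x → ±1. -/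
open Set Filter

/-- `a(x) = ∫₀ˣ (2s + Ū(s))/(1−s²) ds`. -/
noncomputable def aF (U : ℝ → ℝ) (x : ℝ) : ℝ := ∫ s in (0:ℝ)..x, (2*s + U s) / (1 - s^2)

/-- The fundamental theorem of calculus for a continuous function on `(-1, 1)`. -/
theorem hasDerivAt_integral_of_continuousOn_Ioo {f : ℝ → ℝ}
    (hf : ContinuousOn f (Ioo (-1:ℝ) 1)) {x : ℝ} (hx : x ∈ Ioo (-1:ℝ) 1) :
    HasDerivAt (fun y => ∫ s in (0:ℝ)..y, f s) (f x) x := by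
  have hsub : uIcc 0 x ⊆ Ioo (-1:ℝ) 1 :=
    (convex_Ioo (-1:ℝ) 1).ordConnected.uIcc_subset (by constructor <;> norm_num) hx
  exact intervalIntegral.integral_hasDerivAt_right (hf.mono hsub).intervalIntegrable
    (hf.stronglyMeasurableAtFilter isOpen_Ioo x hx) (hf.continuousAt (isOpen_Ioo.mem_nhds hx))

/-- If `a' = (2x + U)/(1 - x²)` and `F' = e^a ξ/(1 - x²)` on `[0, 1)` with `F 0 = 0`, then
`e^{-a} F` inherits the weighted bound on `ξ`, because `e^a (1 - x²)^{1-2ε}` is, up to a bounded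
factor, an increasing function with logarithmic derivative at least `(4ε + v)/(1 - x²)`. -/
theorem abs_exp_neg_mul_le {v α C₀ ε N : ℝ} {a F U ξ : ℝ → ℝ}
    (hα : 0 < α) (hα1 : α ≤ 1) (hC₀ : 0 < C₀) (hε1 : 0 < ε) (hv : 0 < 4 * ε + v)
    (ha : ∀ x ∈ Ico (0:ℝ) 1, HasDerivAt a ((2 * x + U x) / (1 - x^2)) x)
    (hF : ∀ x ∈ Ico (0:ℝ) 1, HasDerivAt F (Real.exp (a x) * ξ x / (1 - x^2)) x)
    (hF0 : F 0 = 0)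
    (hU : ∀ x ∈ Ico (0:ℝ) 1, |U x - v| ≤ C₀ * (1 - x) ^ α)
    (hξ : ∀ x ∈ Ico (0:ℝ) 1, |ξ x| ≤ N * (1 - x^2) ^ (1 - 2 * ε))
    {x : ℝ} (hx : x ∈ Ico (0:ℝ) 1) :
    |Real.exp (-(a x)) * F x| ≤
      Real.exp ((4 * ε + C₀) / α) / (4 * ε + v) * N * (1 - x^2) ^ (1 - 2 * ε) := by
  set K := 4 * ε + C₀ with hK
  have hKpos : 0 < K := by positivity
  have hN : 0 ≤ N := by
    have h := (abs_nonneg _).trans (hξ 0 (by simp))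
    simpa using h
  have hsq : ∀ y ∈ Ico (0:ℝ) 1, 0 < 1 - y^2 := fun y hy => by nlinarith [hy.1, hy.2]
  have hpow : ∀ y ∈ Ico (0:ℝ) 1,
      (1 - y^2) ^ (1 - 2 * ε) = Real.exp ((1 - 2 * ε) * Real.log (1 - y^2)) := fun y hy => by
    rw [Real.rpow_def_of_pos (hsq y hy), mul_comm]
  set g : ℝ → ℝ := fun y =>
    K / α + a y - K / α * (1 - y) ^ α + (1 - 2 * ε) * Real.log (1 - y^2) with hg
  set g' : ℝ → ℝ := fun y =>
    (2 * y + U y) / (1 - y^2) + K * (1 - y) ^ (α - 1) - (1 - 2 * ε) * (2 * y) / (1 - y^2)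
    with hg'
  have hgderiv : ∀ y ∈ Ico (0:ℝ) 1, HasDerivAt g (g' y) y := fun y hy => by
    have h1 : HasDerivAt (fun y : ℝ => (1 - y) ^ α) (-1 * α * (1 - y) ^ (α - 1)) y :=
      ((hasDerivAt_id y).const_sub 1).rpow_const (Or.inl (by simp; linarith [hy.2]))
    have h2 : HasDerivAt (fun y : ℝ => Real.log (1 - y^2)) (-(2 * y) / (1 - y^2)) y := by
      have h3 : HasDerivAt (fun y : ℝ => 1 - y^2) (-(2 * y)) y := by
        simpa using (hasDerivAt_pow 2 y).const_sub 1
      exact h3.log (hsq y hy).ne'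
    refine ((((ha y hy).const_add (K / α)).sub (h1.const_mul (K / α))).add
      (h2.const_mul (1 - 2 * ε))).congr_deriv ?_
    simp only [hg']
    field_simp
    ring
  have hglow : ∀ y ∈ Ico (0:ℝ) 1, (4 * ε + v) / (1 - y^2) ≤ g' y := fun y hy => by
    have hy1 : 0 < 1 - y := by linarith [hy.2]
    have h1 : 1 - y ≤ (1 - y) ^ α := by
      simpa using Real.rpow_le_rpow_of_exponent_ge hy1 (by linarith [hy.1]) hα1
    have h2 : (1 - y) ^ α ≤ (1 - y) ^ (α - 1) * (1 - y^2) := by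
      have h3 : (1 - y) ^ α = (1 - y) ^ (α - 1) * (1 - y) := by
        rw [Real.rpow_sub_one hy1.ne']
        field_simp
      rw [h3]
      exact mul_le_mul_of_nonneg_left (by nlinarith [hy.1, hy.2]) (by positivity)
    have h4 := (abs_le.1 (hU y hy)).1
    have h5 : g' y = (2 * y + U y + K * ((1 - y) ^ (α - 1) * (1 - y^2))
        - (1 - 2 * ε) * (2 * y)) / (1 - y^2) := by
      have := (hsq y hy).ne'
      simp only [hg']
      field_simp
    rw [h5]
    apply div_le_div_of_nonneg_right _ (hsq y hy).le
    have h6 := mul_le_mul_of_nonneg_left h2 hKpos.le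
    have h7 := mul_le_mul_of_nonneg_left h1 hε1.le
    rw [hK] at h6 ⊢
    linarith
  have hkey : ‖F x‖ ≤ N / (4 * ε + v) * Real.exp (g x) := by
    have hmem : ∀ y ∈ Icc 0 x, y ∈ Ico (0:ℝ) 1 := fun y hy => ⟨hy.1, hy.2.trans_lt hx.2⟩
    refine image_norm_le_of_norm_deriv_right_le_deriv_boundary'
      (f := F) (f' := fun y => Real.exp (a y) * ξ y / (1 - y^2)) (a := 0) (b := x)
      (B := fun y => N / (4 * ε + v) * Real.exp (g y))
      (B' := fun y => N / (4 * ε + v) * (Real.exp (g y) * g' y))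
      (fun y hy => (hF y (hmem y hy)).continuousAt.continuousWithinAt)
      (fun y hy => (hF y (hmem y (Ico_subset_Icc_self hy))).hasDerivWithinAt)
      ?_
      (fun y hy => ((hgderiv y (hmem y hy)).exp.const_mul _).continuousAt.continuousWithinAt)
      (fun y hy => ((hgderiv y (hmem y (Ico_subset_Icc_self hy))).exp.const_mul
        _).hasDerivWithinAt)
      ?_ ⟨hx.1, le_rfl⟩
    · rw [hF0, norm_zero]
      positivity
    · intro y hy
      have hy' := hmem y (Ico_subset_Icc_self hy)
      have hs := hsq y hy'
      have h1 : a y + (1 - 2 * ε) * Real.log (1 - y^2) ≤ g y := by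
        have h2 : (1 - y) ^ α ≤ 1 :=
          Real.rpow_le_one (by linarith [hy'.2]) (by linarith [hy'.1]) hα.le
        have h3 := mul_le_mul_of_nonneg_left h2 (div_pos hKpos hα).le
        simp only [hg]
        linarith
      have h4 : |ξ y| * Real.exp (a y) ≤ N * Real.exp (g y) := by
        calc |ξ y| * Real.exp (a y)
            ≤ N * (1 - y^2) ^ (1 - 2 * ε) * Real.exp (a y) := by
              gcongr
              exact hξ y hy'
          _ = N * Real.exp (a y + (1 - 2 * ε) * Real.log (1 - y^2)) := by
              rw [hpow y hy', Real.exp_add]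
              ring
          _ ≤ N * Real.exp (g y) := by gcongr
      calc ‖Real.exp (a y) * ξ y / (1 - y^2)‖
          = |ξ y| * Real.exp (a y) / (1 - y^2) := by
            rw [Real.norm_eq_abs, abs_div, abs_mul, Real.abs_exp, abs_of_pos hs, mul_comm]
        _ ≤ N * Real.exp (g y) / (1 - y^2) := by gcongr
        _ = N / (4 * ε + v) * (Real.exp (g y) * ((4 * ε + v) / (1 - y^2))) := by
            field_simp
        _ ≤ N / (4 * ε + v) * (Real.exp (g y) * g' y) := by
            have := hglow y hy'
            gcongr
  have hgx : g x ≤ K / α + a x + (1 - 2 * ε) * Real.log (1 - x^2) := by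
    have h1 : 0 ≤ (1 - x) ^ α := Real.rpow_nonneg (by linarith [hx.2]) _
    have h2 := mul_nonneg (div_pos hKpos hα).le h1
    simp only [hg]
    linarith
  calc |Real.exp (-(a x)) * F x| = Real.exp (-(a x)) * ‖F x‖ := by
        rw [abs_mul, Real.abs_exp, Real.norm_eq_abs]
    _ ≤ Real.exp (-(a x)) * (N / (4 * ε + v) *
          Real.exp (K / α + a x + (1 - 2 * ε) * Real.log (1 - x^2))) := by
        gcongr
        exact hkey.trans (by gcongr)
    _ = Real.exp (K / α) / (4 * ε + v) * N * (1 - x^2) ^ (1 - 2 * ε) := by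
        rw [hpow x hx, Real.exp_add, Real.exp_add, Real.exp_neg]
        field_simp

/-- in the case `u₋ < 2`, `u₊ > −2`, the operator
`W(x) = e^{−a(x)} ∫₀ˣ e^{a(s)} ξ(s)/(1−s²) ds` solves
`(1−x²)W' + (2x+Ū)W = ξ` with weighted bounds `C·N`, and `W → 0` at `±1`. -/
theorem stmt10 (um up α C₀ ε : ℝ) (hum : um < 2) (hup : -2 < up)
    (hα : 0 < α) (hα1 : α ≤ 1) (hC₀ : 0 < C₀)
    (hε1 : 0 < ε) (hε2 : ε < 1/2) (h4ε1 : um < 4*ε) (h4ε2 : -up < 4*ε) :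
    ∃ C > 0, ∀ (U ξ : ℝ → ℝ) (N : ℝ),
      ContinuousOn U (Ioo (-1:ℝ) 1) →
      (∀ x ∈ Ioc (-1:ℝ) 0, |U x - um| ≤ C₀ * (1+x) ^ α) →
      (∀ x ∈ Ico (0:ℝ) 1, |U x - up| ≤ C₀ * (1-x) ^ α) →
      ContinuousOn ξ (Ioo (-1:ℝ) 1) →
      (∀ x ∈ Ioo (-1:ℝ) 1, |ξ x| ≤ N * (1-x^2) ^ (1-2*ε)) →
      (let W : ℝ → ℝ := fun x =>
        Real.exp (-(aF U x)) * ∫ s in (0:ℝ)..x, Real.exp (aF U s) * ξ s / (1-s^2)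
       ∃ W' : ℝ → ℝ,
        ContinuousOn W' (Ioo (-1:ℝ) 1) ∧
        (∀ x ∈ Ioo (-1:ℝ) 1, HasDerivAt W (W' x) x) ∧
        (∀ x ∈ Ioo (-1:ℝ) 1, (1-x^2) * W' x + (2*x + U x) * W x = ξ x) ∧
        (∀ x ∈ Ioo (-1:ℝ) 1, |W x| ≤ C * N * (1-x^2) ^ (1-2*ε)) ∧
        (∀ x ∈ Ioo (-1:ℝ) 1, (1-x^2) ^ (2*ε) * |W' x| ≤ C * N) ∧
        Tendsto W (nhdsWithin (-1:ℝ) (Ioo (-1:ℝ) 1)) (nhds 0) ∧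
        Tendsto W (nhdsWithin (1:ℝ) (Ioo (-1:ℝ) 1)) (nhds 0)) := by
  have hd1 : 0 < 4 * ε + up := by linarith
  have hd2 : 0 < 4 * ε + -um := by linarith
  set C₁ := Real.exp ((4 * ε + C₀) / α) / (4 * ε + up) with hC₁
  set C₂ := Real.exp ((4 * ε + C₀) / α) / (4 * ε + -um) with hC₂
  have hC₁pos : 0 < C₁ := by positivity
  have hC₂pos : 0 < C₂ := by positivity
  set M := 2 + |um| + |up| + C₀ with hM
  have hMpos : 0 < M := by positivity
  refine ⟨1 + (M + 1) * (C₁ + C₂), by positivity, ?_⟩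
  intro U ξ N hUc hUm hUp hξc hξ W
  have hN : 0 ≤ N := by
    have h := (abs_nonneg _).trans (hξ 0 (by simp))
    simpa using h
  have hsq : ∀ x ∈ Ioo (-1:ℝ) 1, 0 < 1 - x^2 := fun x hx => by nlinarith [hx.1, hx.2]
  have haderiv : ∀ x ∈ Ioo (-1:ℝ) 1, HasDerivAt (aF U) ((2 * x + U x) / (1 - x^2)) x :=
    fun x hx => hasDerivAt_integral_of_continuousOn_Ioo
      (f := fun s => (2 * s + U s) / (1 - s^2))
      (ContinuousOn.div (by fun_prop) (by fun_prop) fun y hy => (hsq y hy).ne') hx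
  have hac : ContinuousOn (aF U) (Ioo (-1:ℝ) 1) :=
    fun x hx => (haderiv x hx).continuousAt.continuousWithinAt
  set F : ℝ → ℝ := fun x => ∫ s in (0:ℝ)..x, Real.exp (aF U s) * ξ s / (1 - s^2) with hF
  have hFderiv : ∀ x ∈ Ioo (-1:ℝ) 1, HasDerivAt F (Real.exp (aF U x) * ξ x / (1 - x^2)) x :=
    fun x hx => hasDerivAt_integral_of_continuousOn_Ioo
      (f := fun s => Real.exp (aF U s) * ξ s / (1 - s^2))
      (ContinuousOn.div (hac.rexp.mul hξc) (by fun_prop) fun y hy => (hsq y hy).ne') hx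
  have hF0 : F 0 = 0 := by simp [hF]
  have hWderiv : ∀ x ∈ Ioo (-1:ℝ) 1,
      HasDerivAt W ((ξ x - (2 * x + U x) * W x) / (1 - x^2)) x := fun x hx => by
    refine HasDerivAt.congr_deriv (f := W) ((haderiv x hx).neg.exp.mul (hFderiv x hx)) ?_
    have hs := (hsq x hx).ne'
    have hW : W x = Real.exp (-(aF U x)) * F x := rfl
    have he : Real.exp (-(aF U x)) * Real.exp (aF U x) = 1 := by
      rw [← Real.exp_add]
      simp
    rw [hW]
    simp only [Pi.neg_apply]
    field_simp
    linear_combination ξ x * he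
  have hWc : ContinuousOn W (Ioo (-1:ℝ) 1) :=
    fun x hx => (hWderiv x hx).continuousAt.continuousWithinAt
  have hbound : ∀ x ∈ Ioo (-1:ℝ) 1, |W x| ≤ (C₁ + C₂) * N * (1 - x^2) ^ (1 - 2 * ε) := by
    intro x hx
    have hp : 0 ≤ N * (1 - x^2) ^ (1 - 2 * ε) :=
      mul_nonneg hN (Real.rpow_nonneg (hsq x hx).le _)
    rcases le_total 0 x with h0 | h0
    · have hmem : ∀ y ∈ Ico (0:ℝ) 1, y ∈ Ioo (-1:ℝ) 1 :=
        fun y hy => ⟨by linarith [hy.1], hy.2⟩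
      have h := abs_exp_neg_mul_le hα hα1 hC₀ hε1 hd1 (fun y hy => haderiv y (hmem y hy))
        (fun y hy => hFderiv y (hmem y hy)) hF0 hUp (fun y hy => hξ y (hmem y hy))
        ⟨h0, hx.2⟩
      rw [← hC₁] at h
      have h' : |W x| ≤ C₁ * N * (1 - x^2) ^ (1 - 2 * ε) := h
      nlinarith [mul_nonneg hC₂pos.le hp]
    · have hmem : ∀ y ∈ Ico (0:ℝ) 1, -y ∈ Ioo (-1:ℝ) 1 :=
        fun y hy => ⟨by linarith [hy.2], by linarith [hy.1]⟩
      have h := abs_exp_neg_mul_le (a := fun y => aF U (-y)) (F := fun y => F (-y))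
        (U := fun y => -U (-y)) (ξ := fun y => -ξ (-y)) (N := N) (x := -x)
        hα hα1 hC₀ hε1 hd2
        (fun y hy => by
          refine ((haderiv (-y) (hmem y hy)).comp y (hasDerivAt_neg y)).congr_deriv ?_
          ring)
        (fun y hy => by
          refine ((hFderiv (-y) (hmem y hy)).comp y (hasDerivAt_neg y)).congr_deriv ?_
          ring)
        (by simpa using hF0)
        (fun y hy => by
          have h1 := hUm (-y) ⟨(hmem y hy).1, by linarith [hy.1]⟩
          rw [← abs_neg, ← sub_eq_add_neg] at h1
          convert h1 using 2
          ring)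
        (fun y hy => by simpa using hξ (-y) (hmem y hy))
        ⟨by linarith, by linarith [hx.1]⟩
      simp only [neg_neg, neg_sq] at h
      rw [← hC₂] at h
      have h' : |W x| ≤ C₂ * N * (1 - x^2) ^ (1 - 2 * ε) := h
      nlinarith [mul_nonneg hC₁pos.le hp]
  have hUbd : ∀ x ∈ Ioo (-1:ℝ) 1, |2 * x + U x| ≤ M := by
    have key : ∀ x v t : ℝ, x ∈ Ioo (-1:ℝ) 1 → 0 ≤ t → t ≤ 1 → |v| ≤ |um| + |up| →
        |U x - v| ≤ C₀ * t ^ α → |2 * x + U x| ≤ M := by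
      intro x v t hx ht0 ht1 hv h
      have h1 : C₀ * t ^ α ≤ C₀ := mul_le_of_le_one_right hC₀.le (Real.rpow_le_one ht0 ht1 hα.le)
      have h2 := abs_le.1 (h.trans h1)
      have h3 := abs_le.1 hv
      rw [hM, abs_le]
      constructor <;> linarith [hx.1, hx.2, h2.1, h2.2, h3.1, h3.2]
    intro x hx
    rcases le_total 0 x with h0 | h0
    · exact key x up (1 - x) hx (by linarith [hx.2]) (by linarith)
        (by linarith [abs_nonneg um]) (hUp x ⟨h0, hx.2⟩)
    · exact key x um (1 + x) hx (by linarith [hx.1]) (by linarith)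
        (by linarith [abs_nonneg up]) (hUm x ⟨hx.1, h0⟩)
  have hlim : ∀ c : ℝ, 1 - c^2 = 0 → Tendsto W (nhdsWithin c (Ioo (-1:ℝ) 1)) (nhds 0) := by
    intro c hc
    have hp : 0 < 1 - 2 * ε := by linarith
    have hcont : Continuous fun x : ℝ => (C₁ + C₂) * N * (1 - x^2) ^ (1 - 2 * ε) :=
      continuous_const.mul ((by fun_prop : Continuous fun x : ℝ => 1 - x^2).rpow_const
        fun _ => Or.inr hp.le)
    have h := (hcont.tendsto c).mono_left (nhdsWithin_le_nhds (s := Ioo (-1:ℝ) 1))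
    simp only [hc, Real.zero_rpow hp.ne', mul_zero] at h
    refine squeeze_zero_norm' ?_ h
    filter_upwards [self_mem_nhdsWithin] with x hx using hbound x hx
  refine ⟨fun x => (ξ x - (2 * x + U x) * W x) / (1 - x^2), ?_, hWderiv, ?_, ?_, ?_,
    hlim (-1) (by norm_num), hlim 1 (by norm_num)⟩
  · exact ContinuousOn.div (by fun_prop) (by fun_prop) fun y hy => (hsq y hy).ne'
  · intro x hx
    have hs := (hsq x hx).ne'
    field_simp
    ring
  · intro x hx
    refine (hbound x hx).trans ?_
    have hp := Real.rpow_nonneg (hsq x hx).le (1 - 2 * ε)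
    refine mul_le_mul_of_nonneg_right (mul_le_mul_of_nonneg_right ?_ hN) hp
    linarith [mul_pos hMpos (add_pos hC₁pos hC₂pos)]
  · intro x hx
    have hs := hsq x hx
    have hq : (1 - x^2) ^ (2 * ε) * (1 - x^2) ^ (1 - 2 * ε) = 1 - x^2 := by
      rw [← Real.rpow_add hs]
      simp
    have hnum : |ξ x - (2 * x + U x) * W x| ≤
        (1 + M * (C₁ + C₂)) * N * (1 - x^2) ^ (1 - 2 * ε) := by
      calc |ξ x - (2 * x + U x) * W x| ≤ |ξ x| + |2 * x + U x| * |W x| := by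
            rw [← abs_mul]
            exact abs_sub _ _
        _ ≤ N * (1 - x^2) ^ (1 - 2 * ε) +
            M * ((C₁ + C₂) * N * (1 - x^2) ^ (1 - 2 * ε)) := by
            gcongr
            · exact hξ x hx
            · exact hUbd x hx
            · exact hbound x hx
        _ = _ := by ring
    have hpos : 0 ≤ (1 - x^2) ^ (2 * ε) := Real.rpow_nonneg hs.le _
    rw [abs_div, abs_of_pos hs, ← mul_div_assoc, div_le_iff₀ hs]
    calc (1 - x^2) ^ (2 * ε) * |ξ x - (2 * x + U x) * W x|
        ≤ (1 - x^2) ^ (2 * ε) * ((1 + M * (C₁ + C₂)) * N * (1 - x^2) ^ (1 - 2 * ε)) := by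
          gcongr
      _ = (1 + M * (C₁ + C₂)) * N * (1 - x^2) := by
          linear_combination ((1 + M * (C₁ + C₂)) * N) * hq
      _ ≤ (1 + (M + 1) * (C₁ + C₂)) * N * (1 - x^2) := by
          gcongr
          linarith
end

section
/- Let Ū : (−1,1) → ℝ be continuous with constants u₋ > 2, u₊ < −2, α ∈ (0,1], C₀ > 0 such that |Ū(x) − u₋| ≤ C₀(1+x)^α on (−1,0] and |Ū(x) − u₊| ≤ C₀(1−x)^α on [0,1). Let ε ∈ (0,1/2), and let ξ : (−1,1) → ℝ be continuous with |ξ(x)| ≤ N(1−x²)^{1−2ε} for all x. Then 0 < ∫_{−1}^{1} e^{a(s)} ds < ∞ and ∫_{−1}^{1} e^{a(s)}|ξ(s)|/(1−s²) ds < ∞, so the constant C_W := (∫_{−1}^{1} e^{a(s)} ξ(s)/(1−s²) ds)/(∫_{−1}^{1} e^{a(s)} ds) is well-defined; moreover there exists C > 0 depending only on ε, u₋, u₊, α, C₀ such that |C_W| ≤ C·N, the function W(x) := e^{−a(x)} ∫_{−1}^{x} e^{a(s)} (ξ(s)/(1−s²) − C_W) ds satisfies |W(x)| ≤ C·N·(1−x²)^{1−2ε}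 for all x ∈ (−1,1), and (1−x²)W'(x) + (2x + Ū(x))W(x) = ξ(x) − C_W(1−x²) on (−1,1). -/
open Set Filter MeasureTheory

lemma continuousOn_aF_integrand {U : ℝ → ℝ} (hU : ContinuousOn U (Ioo (-1:ℝ) 1)) :
    ContinuousOn (fun s => (2*s + U s) / (1 - s^2)) (Ioo (-1:ℝ) 1) := by
  refine ContinuousOn.div (by fun_prop) (by fun_prop) ?_
  intro x hx
  have : 0 < (1 - x) * (1 + x) := mul_pos (by linarith [hx.2]) (by linarith [hx.1])
  nlinarith

lemma hasDerivAt_aF {U : ℝ → ℝ} (hU : ContinuousOn U (Ioo (-1:ℝ) 1)) {x : ℝ}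
    (hx : x ∈ Ioo (-1:ℝ) 1) : HasDerivAt (aF U) ((2*x + U x) / (1 - x^2)) x := by
  have hc := continuousOn_aF_integrand hU
  have hn : Ioo (-1:ℝ) 1 ∈ nhds x := isOpen_Ioo.mem_nhds hx
  refine intervalIntegral.integral_hasDerivAt_right ?_ ?_ (hc.continuousAt hn)
  · exact (hc.mono (ordConnected_Ioo.uIcc_subset (by norm_num) hx)).intervalIntegrable
  · exact hc.stronglyMeasurableAtFilter isOpen_Ioo x hx

lemma aF_neg (U : ℝ → ℝ) (x : ℝ) : aF (fun s => -U (-s)) x = aF U (-x) := by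
  have h := intervalIntegral.integral_comp_neg (a := 0) (b := x)
    (fun s : ℝ => (2*s + U s) / (1 - s^2))
  rw [neg_zero] at h
  unfold aF
  rw [intervalIntegral.integral_symm (-x) 0, ← h, ← intervalIntegral.integral_neg]
  congr 1
  ext s
  rw [← neg_div]
  congr 1 <;> ring

/-- Near `-1` the function `a` differs from `((u₋ - 2)/2) log (1+x)` by a bounded amount. -/
lemma abs_aF_sub_log_le {U : ℝ → ℝ} {um C₀ α : ℝ} (hum : 2 < um) (hα : 0 < α) (hC₀ : 0 < C₀)
    (hU : ContinuousOn U (Ioo (-1:ℝ) 1))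
    (hb : ∀ x ∈ Ioc (-1:ℝ) 0, |U x - um| ≤ C₀ * (1+x) ^ α) {x : ℝ} (hx : x ∈ Ioc (-1:ℝ) 0) :
    |aF U x - (um - 2) / 2 * Real.log (1+x)| ≤ C₀ / α + 2 + (um - 2) / 2 := by
  set β := (um - 2) / 2 with hβ
  have hβ0 : 0 < β := by rw [hβ]; linarith
  have hd : ∀ y ∈ Ioc (-1:ℝ) 0, HasDerivAt (fun y => aF U y - β * Real.log (1+y))
      ((2*y + U y) / (1 - y^2) - β * (1 / (1+y))) y := by
    intro y hy
    have h1 : (1 + y) ≠ 0 := by linarith [hy.1]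
    exact (hasDerivAt_aF hU ⟨hy.1, by linarith [hy.2]⟩).sub
      ((((hasDerivAt_id y).const_add 1).log h1).const_mul β)
  have hp : ∀ y ∈ Ioc (-1:ℝ) 0, HasDerivAt (fun y => C₀ / α * (1+y) ^ α + (2 + β) * y)
      (C₀ * (1+y) ^ (α - 1) + (2 + β)) y := by
    intro y hy
    have h1 : (1 + y) ≠ 0 := by linarith [hy.1]
    have e : C₀ * (1+y) ^ (α - 1) + (2 + β) =
        C₀ / α * (1 * α * (1+y) ^ (α - 1)) + (2 + β) * 1 := by
      field_simp
    rw [e]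
    exact ((((hasDerivAt_id y).const_add 1).rpow_const (p := α) (Or.inl h1)).const_mul
      (C₀ / α)).add ((hasDerivAt_id y).const_mul (2 + β))
  have hle : ∀ y ∈ Ioc (-1:ℝ) 0, |(2*y + U y) / (1 - y^2) - β * (1 / (1+y))| ≤
      C₀ * (1+y) ^ (α - 1) + (2 + β) := by
    intro y hy
    have h1 : 0 < 1 + y := by linarith [hy.1]
    have h2 : 1 ≤ 1 - y := by linarith [hy.2]
    have e : (2*y + U y) / (1 - y^2) - β * (1 / (1+y)) =
        ((U y - um) + (2 + β) * (1 + y)) / ((1 + y) * (1 - y)) := by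
      have h3 : 1 - y ≠ 0 := by linarith
      have h4 : 1 - y^2 = (1 + y) * (1 - y) := by ring
      rw [h4]
      field_simp
      rw [hβ]
      ring
    rw [e, abs_div, abs_of_pos (mul_pos h1 (by linarith : 0 < 1 - y)),
      div_le_iff₀ (mul_pos h1 (by linarith))]
    have hnum : |(U y - um) + (2 + β) * (1 + y)| ≤ C₀ * (1+y) ^ α + (2 + β) * (1 + y) := by
      refine (abs_add_le _ _).trans (add_le_add (hb y hy) ?_)
      rw [abs_of_pos (by positivity)]
    have hr : (1+y) ^ α = (1+y) ^ (α - 1) * (1 + y) := by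
      rw [← Real.rpow_add_one h1.ne']; ring_nf
    have hpos : 0 < (C₀ * (1+y) ^ (α - 1) + (2 + β)) * (1 + y) := by positivity
    rw [hr] at hnum
    nlinarith
  have hint : interior (Ioc (-1:ℝ) 0) ⊆ Ioc (-1:ℝ) 0 := interior_subset
  have h0 : (0:ℝ) ∈ Ioc (-1:ℝ) 0 := by norm_num
  have haz : aF U 0 = 0 := by simp [aF]
  have hmono : MonotoneOn (fun y => (C₀ / α * (1+y) ^ α + (2 + β) * y) +
      (aF U y - β * Real.log (1+y))) (Ioc (-1:ℝ) 0) := by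
    refine monotoneOn_of_hasDerivWithinAt_nonneg (convex_Ioc _ _)
      (fun y hy => ((hp y hy).add (hd y hy)).continuousAt.continuousWithinAt)
      (fun y hy => ((hp y (hint hy)).add (hd y (hint hy))).hasDerivWithinAt) ?_
    intro y hy
    have := abs_le.1 (hle y (hint hy))
    linarith [this.1]
  have hmono' : MonotoneOn (fun y => (C₀ / α * (1+y) ^ α + (2 + β) * y) -
      (aF U y - β * Real.log (1+y))) (Ioc (-1:ℝ) 0) := by
    refine monotoneOn_of_hasDerivWithinAt_nonneg (convex_Ioc _ _)
      (fun y hy => ((hp y hy).sub (hd y hy)).continuousAt.continuousWithinAt)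
      (fun y hy => ((hp y (hint hy)).sub (hd y (hint hy))).hasDerivWithinAt) ?_
    intro y hy
    have := abs_le.1 (hle y (hint hy))
    linarith [this.2]
  have m1 := hmono hx h0 hx.2
  have m2 := hmono' hx h0 hx.2
  simp only [haz, add_zero, Real.log_one, mul_zero, Real.one_rpow, mul_one, sub_zero] at m1 m2
  have h1 : 0 < 1 + x := by linarith [hx.1]
  have h3 : 0 ≤ C₀ / α * (1+x) ^ α := by positivity
  have h4 : -(2 + β) ≤ (2 + β) * x := by nlinarith [hx.1]
  rw [abs_le]
  constructor <;> linarith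

lemma exp_aF_bounds {U : ℝ → ℝ} {um C₀ α K : ℝ} (hum : 2 < um) (hα : 0 < α) (hC₀ : 0 < C₀)
    (hU : ContinuousOn U (Ioo (-1:ℝ) 1))
    (hb : ∀ x ∈ Ioc (-1:ℝ) 0, |U x - um| ≤ C₀ * (1+x) ^ α)
    (hK : C₀ / α + 2 + (um - 2) / 2 ≤ K) {x : ℝ} (hx : x ∈ Ioc (-1:ℝ) 0) :
    Real.exp (aF U x) ≤ Real.exp K * (1+x) ^ ((um - 2) / 2) ∧
    Real.exp (-aF U x) ≤ Real.exp K * (1+x) ^ (-((um - 2) / 2)) := by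
  have h := abs_le.1 ((abs_aF_sub_log_le hum hα hC₀ hU hb hx).trans hK)
  have h1 : 0 < 1 + x := by linarith [hx.1]
  rw [Real.rpow_def_of_pos h1, Real.rpow_def_of_pos h1, ← Real.exp_add, ← Real.exp_add,
    Real.exp_le_exp, Real.exp_le_exp]
  constructor <;> linarith [h.1, h.2]

lemma one_sub_sq_pos {x : ℝ} (hx : x ∈ Ioo (-1:ℝ) 1) : 0 < 1 - x^2 := by
  have : 0 < (1 - x) * (1 + x) := mul_pos (by linarith [hx.2]) (by linarith [hx.1])
  nlinarith

/-- A function dominated by `M (1+s)^(q-1)` on `(-1, 0]` is integrable there, and its primitive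
from `-1` is dominated by `M (1+x)^q / q`. -/
lemma intervalIntegrable_and_abs_integral_le {f : ℝ → ℝ} {M q : ℝ} (hq : 0 < q)
    (hf : ContinuousOn f (Ioo (-1:ℝ) 1))
    (hb : ∀ s ∈ Ioc (-1:ℝ) 0, |f s| ≤ M * (1+s) ^ (q-1)) {x : ℝ} (hx : x ∈ Ioc (-1:ℝ) 0) :
    IntervalIntegrable f volume (-1) x ∧ |∫ s in (-1:ℝ)..x, f s| ≤ M * ((1+x) ^ q / q) := by
  have hsub : Ioc (-1:ℝ) x ⊆ Ioo (-1:ℝ) 1 := fun s hs => ⟨hs.1, by linarith [hs.2, hx.2]⟩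
  have hg : IntervalIntegrable (fun s : ℝ => M * (1+s) ^ (q-1)) volume (-1) x := by
    have h := (intervalIntegral.intervalIntegrable_rpow' (a := 1 + -1) (b := 1 + x)
      (r := q - 1) (by linarith)).comp_add_left 1
    simp only [add_sub_cancel_left] at h
    exact h.const_mul M
  have hbd : ∀ s ∈ Ioc (-1:ℝ) x, ‖f s‖ ≤ M * (1+s) ^ (q-1) :=
    fun s hs => hb s ⟨hs.1, hs.2.trans hx.2⟩
  constructor
  · refine hg.mono_fun' ?_ ?_
    · rw [uIoc_of_le hx.1.le]
      exact (hf.mono hsub).aestronglyMeasurable measurableSet_Ioc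
    · rw [uIoc_of_le hx.1.le]
      exact (ae_restrict_iff' measurableSet_Ioc).2 (Eventually.of_forall hbd)
  · have h := intervalIntegral.norm_integral_le_of_norm_le hx.1.le
      (Eventually.of_forall hbd) hg
    rw [Real.norm_eq_abs] at h
    refine h.trans_eq ?_
    rw [intervalIntegral.integral_const_mul,
      intervalIntegral.integral_comp_add_left (fun s : ℝ => s ^ (q-1)) 1,
      integral_rpow (Or.inl (by linarith))]
    simp [Real.zero_rpow hq.ne']

/-- The mirror image of `intervalIntegrable_and_abs_integral_le`. -/
lemma intervalIntegrable_and_abs_integral_le' {f : ℝ → ℝ} {M q : ℝ} (hq : 0 < q)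
    (hf : ContinuousOn f (Ioo (-1:ℝ) 1))
    (hb : ∀ s ∈ Ioc (-1:ℝ) 0, |f (-s)| ≤ M * (1+s) ^ (q-1)) {x : ℝ} (hx : x ∈ Ico (0:ℝ) 1) :
    IntervalIntegrable f volume x 1 ∧ |∫ s in x..1, f s| ≤ M * ((1-x) ^ q / q) := by
  have hc : ContinuousOn (fun s => f (-s)) (Ioo (-1:ℝ) 1) :=
    hf.comp continuousOn_neg fun s hs => ⟨by linarith [hs.2], by linarith [hs.1]⟩
  obtain ⟨h1, h2⟩ := intervalIntegrable_and_abs_integral_le hq hc hb (x := -x)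
    ⟨by linarith [hx.2], by linarith [hx.1]⟩
  constructor
  · have h := (IntervalIntegrable.iff_comp_neg (f := fun s => f (-s))).1 h1
    simpa using h.symm
  · rw [intervalIntegral.integral_comp_neg] at h2
    simpa [sub_eq_add_neg] using h2

/-- Pointwise bounds near `-1` for the two integrands. -/
lemma integrand_bounds {U ξ : ℝ → ℝ} {um C₀ α K δ N : ℝ} (hum : 2 < um) (hα : 0 < α)
    (hC₀ : 0 < C₀) (hδ : δ ≤ 1) (hU : ContinuousOn U (Ioo (-1:ℝ) 1))
    (hb : ∀ x ∈ Ioc (-1:ℝ) 0, |U x - um| ≤ C₀ * (1+x) ^ α)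
    (hK : C₀ / α + 2 + (um - 2) / 2 ≤ K) (hN : 0 ≤ N)
    (hξ : ∀ x ∈ Ioo (-1:ℝ) 1, |ξ x| ≤ N * (1-x^2) ^ δ) {s : ℝ} (hs : s ∈ Ioc (-1:ℝ) 0) :
    |Real.exp (aF U s)| ≤ Real.exp K * (1+s) ^ ((um - 2) / 2 + δ - 1) ∧
    |Real.exp (aF U s) * ξ s / (1-s^2)| ≤
      Real.exp K * N * (1+s) ^ ((um - 2) / 2 + δ - 1) := by
  have h1 : 0 < 1 + s := by linarith [hs.1]
  have hs' : s ∈ Ioo (-1:ℝ) 1 := ⟨hs.1, by linarith [hs.2]⟩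
  have h2 := one_sub_sq_pos hs'
  have hE := (exp_aF_bounds hum hα hC₀ hU hb hK hs).1
  have hsplit : (1+s) ^ ((um - 2) / 2 + δ - 1) = (1+s) ^ ((um - 2) / 2) * (1+s) ^ (δ - 1) := by
    rw [← Real.rpow_add h1]; ring_nf
  have hone : 1 ≤ (1+s) ^ (δ - 1) :=
    Real.one_le_rpow_of_pos_of_le_one_of_nonpos h1 (by linarith [hs.2]) (by linarith)
  have hw : (1-s^2) ^ (δ - 1) ≤ (1+s) ^ (δ - 1) :=
    Real.rpow_le_rpow_of_nonpos h1 (by nlinarith [hs.1, hs.2]) (by linarith)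
  have hβ : 0 ≤ Real.exp K * (1+s) ^ ((um - 2) / 2) := by positivity
  rw [hsplit]
  constructor
  · rw [Real.abs_exp, ← mul_assoc]
    exact hE.trans (le_mul_of_one_le_right hβ hone)
  · rw [mul_div_assoc, abs_mul, Real.abs_exp, abs_div, abs_of_pos h2]
    have hq : |ξ s| / (1 - s^2) ≤ N * (1+s) ^ (δ - 1) := by
      rw [div_le_iff₀ h2]
      calc |ξ s| ≤ N * (1-s^2) ^ δ := hξ s hs'
        _ = N * (1-s^2) ^ (δ - 1) * (1-s^2) := by
            rw [mul_assoc, ← Real.rpow_add_one h2.ne']; ring_nf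
        _ ≤ _ := by gcongr
    calc _ ≤ (Real.exp K * (1+s) ^ ((um - 2) / 2)) * (N * (1+s) ^ (δ - 1)) := by
            gcongr
      _ = _ := by ring

/-- Combining the growth of `e^{-a}` with the decay of the primitive near `-1`. -/
lemma exp_neg_mul_primitive_le {K β δ q M I a x : ℝ} (hδ : 0 < δ) (hq : q = β + δ) (hq0 : 0 < q)
    (hM : 0 ≤ M) (hx : x ∈ Ioc (-1:ℝ) 0) (ha : Real.exp (-a) ≤ Real.exp K * (1+x) ^ (-β))
    (hI : |I| ≤ M * ((1+x) ^ q / q)) :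
    |Real.exp (-a) * I| ≤ Real.exp K * M / q * (1-x^2) ^ δ := by
  have h1 : 0 < 1 + x := by linarith [hx.1]
  have hw : (1+x) ^ δ ≤ (1-x^2) ^ δ :=
    Real.rpow_le_rpow h1.le (by nlinarith [hx.1, hx.2]) hδ.le
  have he : (1+x) ^ (-β) * (1+x) ^ q = (1+x) ^ δ := by
    rw [← Real.rpow_add h1, hq]; ring_nf
  rw [abs_mul, Real.abs_exp]
  calc _ ≤ (Real.exp K * (1+x) ^ (-β)) * (M * ((1+x) ^ q / q)) := by gcongr
    _ = Real.exp K * M / q * ((1+x) ^ (-β) * (1+x) ^ q) := by ring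
    _ ≤ _ := by rw [he]; gcongr

/-- A lower bound for the total mass of `e^a`. -/
lemma le_integral_exp_aF {U : ℝ → ℝ} {um C₀ α K : ℝ} (hum : 2 < um) (hα : 0 < α) (hC₀ : 0 < C₀)
    (hU : ContinuousOn U (Ioo (-1:ℝ) 1))
    (hb : ∀ x ∈ Ioc (-1:ℝ) 0, |U x - um| ≤ C₀ * (1+x) ^ α)
    (hK : C₀ / α + 2 + (um - 2) / 2 ≤ K)
    (hi : IntervalIntegrable (fun s => Real.exp (aF U s)) volume (-1) 1) :
    1 / 2 * (Real.exp K * (1 / 2) ^ (-((um - 2) / 2)))⁻¹ ≤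
      ∫ s in (-1:ℝ)..1, Real.exp (aF U s) := by
  have h1 : ∫ s in (-(1/2):ℝ)..0, (Real.exp K * (1 / 2) ^ (-((um - 2) / 2)))⁻¹ ≤
      ∫ s in (-(1/2):ℝ)..0, Real.exp (aF U s) := by
    refine intervalIntegral.integral_mono_on (by norm_num) intervalIntegrable_const
      (hi.mono_set ?_) ?_
    · rw [uIcc_of_le (by norm_num), uIcc_of_le (by norm_num)]
      exact Icc_subset_Icc (by norm_num) (by norm_num)
    · intro s hs
      have h := (exp_aF_bounds hum hα hC₀ hU hb hK
        (x := s) ⟨by linarith [hs.1], hs.2⟩).2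
      have hw : (1 + s) ^ (-((um - 2) / 2)) ≤ (1 / 2 : ℝ) ^ (-((um - 2) / 2)) :=
        Real.rpow_le_rpow_of_nonpos (by norm_num) (by linarith [hs.1]) (by linarith)
      rw [← inv_inv (Real.exp (aF U s)), ← Real.exp_neg]
      refine inv_anti₀ (Real.exp_pos _) (h.trans ?_)
      gcongr
  have h2 : ∫ s in (-(1/2):ℝ)..0, Real.exp (aF U s) ≤ ∫ s in (-1:ℝ)..1, Real.exp (aF U s) :=
    intervalIntegral.integral_mono_interval (by norm_num) (by norm_num) (by norm_num)
      (Eventually.of_forall fun s => (Real.exp_pos _).le) hi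
  rw [intervalIntegral.integral_const, smul_eq_mul] at h1
  linarith

lemma abs_integral_le_of_bounds {f : ℝ → ℝ} {M q r : ℝ} (hq : 0 < q) (hr : 0 < r)
    (hf : ContinuousOn f (Ioo (-1:ℝ) 1))
    (hb : ∀ s ∈ Ioc (-1:ℝ) 0, |f s| ≤ M * (1+s) ^ (q-1))
    (hb' : ∀ s ∈ Ioc (-1:ℝ) 0, |f (-s)| ≤ M * (1+s) ^ (r-1)) :
    IntervalIntegrable f volume (-1) 1 ∧ |∫ s in (-1:ℝ)..1, f s| ≤ M * (1 / q + 1 / r) := by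
  obtain ⟨i1, e1⟩ := intervalIntegrable_and_abs_integral_le hq hf hb (x := 0) (by norm_num)
  obtain ⟨i2, e2⟩ := intervalIntegrable_and_abs_integral_le' hr hf hb' (x := 0) (by norm_num)
  refine ⟨i1.trans i2, ?_⟩
  rw [← intervalIntegral.integral_add_adjacent_intervals i1 i2]
  simp only [add_zero, sub_zero, Real.one_rpow] at e1 e2
  refine (abs_add_le _ _).trans ?_
  linarith

/-- in the case `u₋ > 2`, `u₊ < −2`, the constant
`C_W = (∫₋₁¹ e^{a} ξ/(1−s²))/(∫₋₁¹ e^{a})` is well defined, `|C_W| ≤ C·N`, and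
`W(x) = e^{−a(x)} ∫_{−1}ˣ e^{a(s)} (ξ(s)/(1−s²) − C_W) ds` satisfies the weighted bound
and the ODE `(1−x²)W' + (2x+Ū)W = ξ − C_W(1−x²)`. -/
theorem stmt12 (um up α C₀ ε : ℝ) (hum : 2 < um) (hup : up < -2)
    (hα : 0 < α) (hα1 : α ≤ 1) (hC₀ : 0 < C₀)
    (hε1 : 0 < ε) (hε2 : ε < 1/2) :
    ∃ C > 0, ∀ (U ξ : ℝ → ℝ) (N : ℝ),
      ContinuousOn U (Ioo (-1:ℝ) 1) →
      (∀ x ∈ Ioc (-1:ℝ) 0, |U x - um| ≤ C₀ * (1+x) ^ α) →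
      (∀ x ∈ Ico (0:ℝ) 1, |U x - up| ≤ C₀ * (1-x) ^ α) →
      ContinuousOn ξ (Ioo (-1:ℝ) 1) →
      (∀ x ∈ Ioo (-1:ℝ) 1, |ξ x| ≤ N * (1-x^2) ^ (1-2*ε)) →
      IntervalIntegrable (fun s => Real.exp (aF U s)) volume (-1) 1 ∧
      (0 < ∫ s in (-1:ℝ)..1, Real.exp (aF U s)) ∧
      IntervalIntegrable (fun s => Real.exp (aF U s) * |ξ s| / (1-s^2)) volume (-1) 1 ∧
      (let CW : ℝ :=
        (∫ s in (-1:ℝ)..1, Real.exp (aF U s) * ξ s / (1-s^2))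
          / ∫ s in (-1:ℝ)..1, Real.exp (aF U s)
       let W : ℝ → ℝ := fun x =>
        Real.exp (-(aF U x))
          * ∫ s in (-1:ℝ)..x, (Real.exp (aF U s) * ξ s / (1-s^2)
              - Real.exp (aF U s) * CW)
       |CW| ≤ C * N ∧
       (∀ x ∈ Ioo (-1:ℝ) 1, |W x| ≤ C * N * (1-x^2) ^ (1-2*ε)) ∧
       ∃ W' : ℝ → ℝ,
        (∀ x ∈ Ioo (-1:ℝ) 1, HasDerivAt W (W' x) x) ∧
        (∀ x ∈ Ioo (-1:ℝ) 1,
          (1-x^2) * W' x + (2*x + U x) * W x = ξ x - CW * (1-x^2))) := by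
  set δ := 1 - 2 * ε with hδ
  have hδ0 : 0 < δ := by rw [hδ]; linarith
  have hδ1 : δ ≤ 1 := by rw [hδ]; linarith
  have hup' : 2 < -up := by linarith
  set K := C₀ / α + 2 + (um - 2) / 2 + (-up - 2) / 2 with hK
  have hK1 : C₀ / α + 2 + (um - 2) / 2 ≤ K := by rw [hK]; linarith
  have hK2 : C₀ / α + 2 + (-up - 2) / 2 ≤ K := by rw [hK]; linarith
  set q := (um - 2) / 2 + δ with hq
  set r := (-up - 2) / 2 + δ with hr
  have hq0 : 0 < q := by rw [hq]; linarith
  have hr0 : 0 < r := by rw [hr]; linarith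
  set A := Real.exp K with hA
  have hA0 : 0 < A := Real.exp_pos K
  set c := 1 / 2 * (A * (1 / 2) ^ (-((um - 2) / 2)))⁻¹ with hc
  have hc0 : 0 < c := by rw [hc]; positivity
  set B := A * (1 / q + 1 / r) / c with hB
  have hB0 : 0 < B := by rw [hB]; positivity
  refine ⟨B + A * (A * (1 + B)) * (1 / q + 1 / r), by positivity, ?_⟩
  intro U ξ N hU hbm hbp hξc hξ
  have hN : 0 ≤ N := by
    have := (abs_nonneg _).trans (hξ 0 (by norm_num))
    simpa using this
  have hneg : ∀ s ∈ Ioo (-1:ℝ) 1, -s ∈ Ioo (-1:ℝ) 1 :=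
    fun s hs => ⟨by linarith [hs.2], by linarith [hs.1]⟩
  have hV : ContinuousOn (fun s => -U (-s)) (Ioo (-1:ℝ) 1) :=
    (hU.comp continuousOn_neg hneg).neg
  have hbV : ∀ x ∈ Ioc (-1:ℝ) 0, |(fun s => -U (-s)) x - -up| ≤ C₀ * (1+x) ^ α := by
    intro x hx
    have h := hbp (-x) ⟨by linarith [hx.2], by linarith [hx.1]⟩
    rw [sub_neg_eq_add] at h
    rwa [show (fun s => -U (-s)) x - -up = -(U (-x) - up) by ring, abs_neg]
  have hη : ∀ x ∈ Ioo (-1:ℝ) 1, |ξ (-x)| ≤ N * (1-x^2) ^ δ := by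
    intro x hx
    simpa using hξ (-x) (hneg x hx)
  have bl := fun s hs => integrand_bounds hum hα hC₀ hδ1 hU hbm hK1 hN hξ (s := s) hs
  have br : ∀ s ∈ Ioc (-1:ℝ) 0, |Real.exp (aF U (-s))| ≤ A * (1+s) ^ (r - 1) ∧
      |Real.exp (aF U (-s)) * ξ (-s) / (1-(-s)^2)| ≤ A * N * (1+s) ^ (r - 1) := by
    intro s hs
    have h := integrand_bounds hup' hα hC₀ hδ1 hV hbV hK2 hN (ξ := fun s => ξ (-s)) hη hs
    rwa [aF_neg, ← neg_sq s] at h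
  have hE : ContinuousOn (fun s => Real.exp (aF U s)) (Ioo (-1:ℝ) 1) :=
    Real.continuous_exp.comp_continuousOn
      fun x hx => (hasDerivAt_aF hU hx).continuousAt.continuousWithinAt
  have hf : ContinuousOn (fun s => Real.exp (aF U s) * ξ s / (1-s^2)) (Ioo (-1:ℝ) 1) :=
    (hE.mul hξc).div (by fun_prop) fun x hx => (one_sub_sq_pos hx).ne'
  obtain ⟨iE, -⟩ := abs_integral_le_of_bounds hq0 hr0 hE
    (fun s hs => (bl s hs).1) (fun s hs => (br s hs).1)
  obtain ⟨iF, eF⟩ := abs_integral_le_of_bounds hq0 hr0 hf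
    (fun s hs => (bl s hs).2) (fun s hs => (br s hs).2)
  have hmass := le_integral_exp_aF hum hα hC₀ hU hbm hK1 iE
  have hmass0 : 0 < ∫ s in (-1:ℝ)..1, Real.exp (aF U s) := hc0.trans_le hmass
  refine ⟨iE, hmass0, ?_, ?_⟩
  · refine iF.abs.congr_ae ?_
    rw [uIoc_of_le (by norm_num)]
    refine (ae_restrict_iff' measurableSet_Ioc).2 (Eventually.of_forall fun s hs => ?_)
    have h : 0 ≤ 1 - s^2 := by nlinarith [hs.1, hs.2]
    simp only [abs_div, abs_mul, Real.abs_exp, abs_of_nonneg h]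
  intro CW W
  have hCW : |CW| ≤ B * N := by
    simp only [CW]
    rw [abs_div, abs_of_pos hmass0, div_le_iff₀ hmass0]
    calc _ ≤ A * N * (1 / q + 1 / r) := eF
      _ = B * N * c := by rw [hB]; field_simp
      _ ≤ _ := by gcongr
  set g : ℝ → ℝ := fun s => Real.exp (aF U s) * ξ s / (1-s^2) - Real.exp (aF U s) * CW with hg
  have hgc : ContinuousOn g (Ioo (-1:ℝ) 1) := hf.sub (hE.mul continuousOn_const)
  have hcomb : ∀ u v w : ℝ, |u| ≤ A * w → |v| ≤ A * N * w →
      |v - u * CW| ≤ A * (1 + B) * N * w := by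
    intro u v w hu hv
    have h : |u| * |CW| ≤ A * w * (B * N) :=
      mul_le_mul hu hCW (abs_nonneg _) ((abs_nonneg _).trans hu)
    refine (abs_sub _ _).trans ?_
    rw [abs_mul]
    linarith
  have gl : ∀ s ∈ Ioc (-1:ℝ) 0, |g s| ≤ A * (1 + B) * N * (1+s) ^ (q - 1) :=
    fun s hs => hcomb _ _ _ (bl s hs).1 (bl s hs).2
  have gr : ∀ s ∈ Ioc (-1:ℝ) 0, |g (-s)| ≤ A * (1 + B) * N * (1+s) ^ (r - 1) :=
    fun s hs => hcomb _ _ _ (br s hs).1 (br s hs).2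
  have ig : IntervalIntegrable g volume (-1) 1 := iF.sub (iE.mul_const CW)
  have hzero : ∫ s in (-1:ℝ)..1, g s = 0 := by
    rw [hg, intervalIntegral.integral_sub iF (iE.mul_const CW),
      intervalIntegral.integral_mul_const]
    simp only [CW]
    field_simp
    ring
  have hM : 0 ≤ A * (1 + B) * N := by positivity
  have igx : ∀ x ∈ Ioo (-1:ℝ) 1, IntervalIntegrable g volume (-1) x := by
    intro x hx
    refine ig.mono_set ?_
    rw [uIcc_of_le hx.1.le, uIcc_of_le (by norm_num)]
    exact Icc_subset_Icc le_rfl hx.2.le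
  refine ⟨hCW.trans ?_, ?_, ?_⟩
  · gcongr
    have : 0 < A * (A * (1 + B)) * (1 / q + 1 / r) := by positivity
    linarith
  · intro x hx
    have hp : 0 ≤ (1 - x^2) ^ δ := Real.rpow_nonneg (one_sub_sq_pos hx).le _
    have hfin : ∀ p : ℝ, 1 / p ≤ 1 / q + 1 / r → A * (A * (1 + B) * N) / p * (1-x^2) ^ δ ≤
        (B + A * (A * (1 + B)) * (1 / q + 1 / r)) * N * (1-x^2) ^ δ := by
      intro p hpq
      have h : A * (A * (1 + B)) * N * (1 / p) ≤
          A * (A * (1 + B)) * N * (1 / q + 1 / r) := by gcongr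
      have h' : 0 ≤ B * N := by positivity
      refine mul_le_mul_of_nonneg_right ?_ hp
      calc _ = A * (A * (1 + B)) * N * (1 / p) := by ring
        _ ≤ _ := by linarith
    have hq1 : 0 < 1 / q := by positivity
    have hr1 : 0 < 1 / r := by positivity
    rcases le_total x 0 with h0 | h0
    · have hx' : x ∈ Ioc (-1:ℝ) 0 := ⟨hx.1, h0⟩
      exact (exp_neg_mul_primitive_le hδ0 hq hq0 hM hx'
        (exp_aF_bounds hum hα hC₀ hU hbm hK1 hx').2
        (intervalIntegrable_and_abs_integral_le hq0 hgc gl hx').2).trans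
        (hfin q (by linarith))
    · have hx' : -x ∈ Ioc (-1:ℝ) 0 := ⟨by linarith [hx.2], by linarith⟩
      obtain ⟨ix, ex⟩ := intervalIntegrable_and_abs_integral_le' hr0 hgc gr ⟨h0, hx.2⟩
      have hsum := intervalIntegral.integral_add_adjacent_intervals (igx x hx) ix
      rw [hzero] at hsum
      have hI : |∫ s in (-1:ℝ)..x, g s| ≤ A * (1 + B) * N * ((1 + -x) ^ r / r) := by
        rwa [eq_neg_of_add_eq_zero_left hsum, abs_neg]
      have ha := (exp_aF_bounds hup' hα hC₀ hV hbV hK2 hx').2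
      rw [aF_neg, neg_neg] at ha
      have h := exp_neg_mul_primitive_le hδ0 hr hr0 hM hx' ha hI
      rw [neg_sq] at h
      exact h.trans (hfin r (by linarith))
  · refine ⟨fun x => Real.exp (-(aF U x)) * -((2*x + U x) / (1 - x^2)) *
      (∫ s in (-1:ℝ)..x, g s) + Real.exp (-(aF U x)) * g x, ?_, ?_⟩
    · intro x hx
      have hd : HasDerivAt (fun x => ∫ s in (-1:ℝ)..x, g s) (g x) x :=
        intervalIntegral.integral_hasDerivAt_right (igx x hx)
          (hgc.stronglyMeasurableAtFilter isOpen_Ioo x hx)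
          (hgc.continuousAt (isOpen_Ioo.mem_nhds hx))
      exact (hasDerivAt_aF hU hx).neg.exp.mul hd
    · intro x hx
      have h := (one_sub_sq_pos hx).ne'
      have he : Real.exp (-(aF U x)) * Real.exp (aF U x) = 1 := by
        rw [← Real.exp_add]; simp
      have hgx : Real.exp (-(aF U x)) * g x = ξ x / (1 - x^2) - CW := by
        rw [hg]
        calc _ = (Real.exp (-(aF U x)) * Real.exp (aF U x)) * (ξ x / (1 - x^2) - CW) := by ring
          _ = _ := by rw [he, one_mul]
      have hW : W x = Real.exp (-(aF U x)) * ∫ s in (-1:ℝ)..x, g s := rfl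
      simp only [hW, hgx]
      field_simp
      ring
end
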